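/- Stability of ECD under a single-label modification: if d' : U → B agrees with d on every object except possibly a single object x₀ (d'(y) = d(y) for all y ≠ x₀), then |ECD(c,d') − ECD(c,d)| ≤ 1/|U|. -/

import Mathlib

open Finset

/-- Classification confidence `Conf(X→Y) = |X∩Y|/|X|` for the conditional block
`X = c⁻¹(a)` and decision class `Y = d⁻¹(b)`. -/
def Conf {U A B : Type*} [Fintype U] [DecidableEq A] [DecidableEq B]
    (c : U → A) (d : U → B) (a : A) (b : B) : ℚ :=
  ((univ.filter fun x => c x = a ∧ d x = b).card : ℚ) /
    ((univ.filter fun x => c x = a).card : ℚ)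

/-- Expected Confidence Dependency:
`ECD(c,d) = (1/|U|) · Σ_{X ∈ U/c} |X| · max_{Y ∈ U/d} Conf(X→Y)`. -/
def ECD {U A B : Type*} [Fintype U] [Nonempty U] [DecidableEq A] [DecidableEq B]
    (c : U → A) (d : U → B) : ℚ :=
  (∑ a ∈ univ.image c,
      ((univ.filter fun x => c x = a).card : ℚ) *
        (univ.image d).sup' (univ_nonempty.image d) (fun b => Conf c d a b))
    / (Fintype.card U : ℚ)

section
variable {U A B : Type*} [Fintype U] [DecidableEq A] [DecidableEq B]

lemma card_mul_Conf (c : U → A) (d : U → B) (a : A) (b : B) :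
    ((univ.filter fun x => c x = a).card : ℚ) * Conf c d a b =
      ((univ.filter fun x => c x = a ∧ d x = b).card : ℚ) := by
  have hle : (univ.filter fun x => c x = a ∧ d x = b).card ≤
      (univ.filter fun x => c x = a).card :=
    card_le_card (monotone_filter_right _ fun _ _ h => h.1)
  unfold Conf
  refine mul_div_cancel_of_imp' fun h => ?_
  have h0 : (univ.filter fun x => c x = a).card = 0 := by exact_mod_cast h
  exact_mod_cast Nat.le_zero.mp (h0 ▸ hle)

lemma card_filter_le_of_agree (c : U → A) (d d' : U → B) (x₀ : U)
    (hagree : ∀ y : U, y ≠ x₀ → d' y = d y) (a : A) (b : B) :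
    (univ.filter fun x => c x = a ∧ d' x = b).card ≤
      (univ.filter fun x => c x = a ∧ d x = b).card + if a = c x₀ then 1 else 0 := by
  classical
  split_ifs with ha
  · refine (card_le_card fun x hx => ?_).trans (card_insert_le x₀ _)
    by_cases hx₀ : x = x₀
    · exact mem_insert.mpr (Or.inl hx₀)
    · simpa [hx₀, hagree x hx₀] using hx
  · refine card_le_card fun x hx => ?_
    have hx₀ : x ≠ x₀ := by
      rintro rfl
      exact ha (mem_filter.mp hx).2.1.symm
    simpa [hagree x hx₀] using hx

variable [Nonempty U]

lemma card_le_card_mul_sup'_Conf (c : U → A) (d : U → B) (a : A) (b : B) :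
    ((univ.filter fun x => c x = a ∧ d x = b).card : ℚ) ≤
      ((univ.filter fun x => c x = a).card : ℚ) *
        (univ.image d).sup' (univ_nonempty.image d) (fun b => Conf c d a b) := by
  have hmem : ∀ b ∈ univ.image d, ((univ.filter fun x => c x = a ∧ d x = b).card : ℚ) ≤
      ((univ.filter fun x => c x = a).card : ℚ) *
        (univ.image d).sup' (univ_nonempty.image d) (fun b => Conf c d a b) := by
    intro b hb
    rw [← card_mul_Conf]
    exact mul_le_mul_of_nonneg_left (le_sup' (fun b => Conf c d a b) hb) (Nat.cast_nonneg _)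
  by_cases hb : b ∈ univ.image d
  · exact hmem b hb
  · have h0 : (univ.filter fun x => c x = a ∧ d x = b) = ∅ :=
      filter_eq_empty_iff.mpr fun x _ h => hb (mem_image.mpr ⟨x, mem_univ x, h.2⟩)
    obtain ⟨b', hb'⟩ := univ_nonempty.image d
    rw [h0, card_empty, Nat.cast_zero]
    exact (Nat.cast_nonneg _).trans (hmem b' hb')

lemma ECD_le_add_of_agree (c : U → A) (d d' : U → B) (x₀ : U)
    (hagree : ∀ y : U, y ≠ x₀ → d' y = d y) :
    ECD c d' ≤ ECD c d + 1 / (Fintype.card U : ℚ) := by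
  unfold ECD
  rw [← add_div]
  refine div_le_div_of_nonneg_right ?_ (Nat.cast_nonneg _)
  have hone : ∑ a ∈ univ.image c, (if a = c x₀ then (1 : ℚ) else 0) = 1 := by
    simp
  rw [← hone, ← sum_add_distrib]
  refine sum_le_sum fun a _ => ?_
  obtain ⟨b, -, hb⟩ := exists_mem_eq_sup' (univ_nonempty.image d') (fun b => Conf c d' a b)
  rw [hb, card_mul_Conf]
  have hcard : ((univ.filter fun x => c x = a ∧ d' x = b).card : ℚ) ≤
      ((univ.filter fun x => c x = a ∧ d x = b).card : ℚ) + if a = c x₀ then 1 else 0 := by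
    exact_mod_cast card_filter_le_of_agree c d d' x₀ hagree a b
  exact hcard.trans (add_le_add_left (card_le_card_mul_sup'_Conf c d a b) _)

end

/-- Stability under a single-label modification: if `d'` agrees with `d` on every
object except possibly `x₀`, then `|ECD(c,d') − ECD(c,d)| ≤ 1/|U|`. -/
theorem ECD_single_label_stability {U A B : Type*} [Fintype U] [Nonempty U]
    [DecidableEq A] [DecidableEq B] (c : U → A) (d d' : U → B) (x₀ : U)
    (hagree : ∀ y : U, y ≠ x₀ → d' y = d y) :
    |ECD c d' - ECD c d| ≤ 1 / (Fintype.card U : ℚ) := by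
  rw [abs_sub_le_iff, sub_le_iff_le_add', sub_le_iff_le_add']
  exact ⟨ECD_le_add_of_agree c d d' x₀ hagree,
    ECD_le_add_of_agree c d' d x₀ fun y hy => (hagree y hy).symm⟩
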